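/- Let 0 < a < min{c,1} and c ≤ a + 1/2. Then the function f(r) = r·𝕂_{a,c}(r)/artanh(r) is strictly decreasing on (0,1), with f(r) → B/2 as r → 0+ and f(r) → 1 as r → 1−, where B = B(a, c−a). In particular, 1 < r·𝕂_{a,c}(r)/artanh(r) < B/2 for all r ∈ (0,1). -/

import Mathlib

open Filter Set

/-- Shifted factorial (Appell symbol) `(a,n) = a(a+1)⋯(a+n−1)`, with `(a,0)=1`. -/
noncomputable def shiftedFact (a : ℝ) (n : ℕ) : ℝ := ∏ i ∈ Finset.range n, (a + i)

/-- Gaussian hypergeometric function `F(a,b;c;x)` as a real power series. -/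
noncomputable def hypF (a b c x : ℝ) : ℝ :=
  ∑' n : ℕ, (shiftedFact a n * shiftedFact b n / (shiftedFact c n * (n.factorial : ℝ))) * x ^ n

/-- Beta function `B(x,y) = Γ(x)Γ(y)/Γ(x+y)`. -/
noncomputable def betaR (x y : ℝ) : ℝ := Real.Gamma x * Real.Gamma y / Real.Gamma (x + y)

/-- Generalized complete elliptic integral of the first kind `𝕂_{a,b,c}(r)`. -/
noncomputable def Kg (a b c r : ℝ) : ℝ := betaR a b / 2 * hypF a b c (r ^ 2)

/-- Generalized complete elliptic integral of the second kind `𝔼_{a,b,c}(r)`. -/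
noncomputable def Eg (a b c r : ℝ) : ℝ := betaR a b / 2 * hypF (a - 1) b c (r ^ 2)

/-- Inverse hyperbolic tangent `artanh x = (1/2) log((1+x)/(1−x))`. -/
noncomputable def artanhR (x : ℝ) : ℝ := (1 / 2) * Real.log ((1 + x) / (1 - x))

/-- If the coefficient ratios `T n` of two positive power series decrease strictly, then so does the
quotient of the series. -/
theorem tsum_mul_pow_cross_lt {T v : ℕ → ℝ} {x y : ℝ} (hT : StrictAnti T) (hv : ∀ n, 0 < v n)
    (hx : 0 < x) (hxy : x < y)
    (hqx : Summable fun n => v n * x ^ n) (hqy : Summable fun n => v n * y ^ n)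
    (hpx : Summable fun n => T n * (v n * x ^ n)) (hpy : Summable fun n => T n * (v n * y ^ n)) :
    (∑' n, T n * (v n * y ^ n)) * (∑' n, v n * x ^ n) <
      (∑' n, T n * (v n * x ^ n)) * (∑' n, v n * y ^ n) := by
  have hy : 0 < y := hx.trans hxy
  set qx := ∑' n, v n * x ^ n
  set qy := ∑' n, v n * y ^ n
  have hqx0 : 0 < qx := hqx.tsum_pos (fun n => by have := hv n; positivity) 0
    (by have := hv 0; positivity)
  have hlt : qx < qy := by
    refine Summable.tsum_lt_tsum (i := 1) (fun n => ?_) ?_ hqx hqy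
    · have := (hv n).le
      gcongr
    · have := hv 1
      simpa using mul_lt_mul_of_pos_left hxy this
  have hxr : 1 < y / x := (one_lt_div hx).2 hxy
  have hex : ∃ n, qy / qx ≤ (y / x) ^ n := by
    obtain ⟨n, hn⟩ := pow_unbounded_of_one_lt (qy / qx) hxr
    exact ⟨n, hn.le⟩
  classical
  set N := Nat.find hex
  have hNspec : qy / qx ≤ (y / x) ^ N := Nat.find_spec hex
  have hN0 : N ≠ 0 := by
    intro h
    rw [h, pow_zero, div_le_one hqx0] at hNspec
    linarith
  have hhi : ∀ n, N ≤ n → x ^ n * qy ≤ y ^ n * qx := by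
    intro n hn
    have h := hNspec.trans (pow_le_pow_right₀ hxr.le hn)
    rw [div_pow, div_le_div_iff₀ hqx0 (by positivity)] at h
    linarith
  have hlo : ∀ n, n < N → y ^ n * qx < x ^ n * qy := by
    intro n hn
    have h := not_le.1 (Nat.find_min hex hn)
    rw [div_pow, div_lt_div_iff₀ (by positivity) hqx0] at h
    linarith
  have hsum : HasSum (fun n => (T n - T N) * (v n * (x ^ n * qy - y ^ n * qx)))
      ((∑' n, T n * (v n * x ^ n)) * qy - (∑' n, T n * (v n * y ^ n)) * qx
        - T N * (qx * qy - qy * qx)) := by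
    have h := ((hpx.hasSum.mul_right qy).sub (hpy.hasSum.mul_right qx)).sub
      (((hqx.hasSum.mul_right qy).sub (hqy.hasSum.mul_right qx)).mul_left (T N))
    refine h.congr_fun fun n => ?_
    ring
  have hpos : 0 < ∑' n, (T n - T N) * (v n * (x ^ n * qy - y ^ n * qx)) := by
    refine hsum.summable.tsum_pos (fun n => ?_) 0 ?_
    · rcases lt_or_ge n N with h | h
      · exact mul_nonneg (sub_nonneg.2 (hT h).le)
          (mul_nonneg (hv n).le (sub_nonneg.2 (hlo n h).le))
      · exact mul_nonneg_of_nonpos_of_nonpos (sub_nonpos.2 (hT.antitone h))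
          (mul_nonpos_of_nonneg_of_nonpos (hv n).le (sub_nonpos.2 (hhi n h)))
    · have h0 : 0 < N := Nat.pos_of_ne_zero hN0
      exact mul_pos (sub_pos.2 (hT h0)) (mul_pos (hv 0) (sub_pos.2 (hlo 0 h0)))
  rw [hsum.tsum_eq] at hpos
  nlinarith

/-- Abelian theorem for quotients of power series with divergent denominator. -/
theorem eventually_tsum_mul_pow_div_lt {ι : Type*} {l : Filter ι} {X : ι → ℝ} {T v : ℕ → ℝ}
    {L M : ℝ} (hLM : L < M) (hT : ∀ n, 0 ≤ T n) (hv : ∀ n, 0 ≤ v n)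
    (hL : Tendsto T atTop (nhds L)) (hX : ∀ᶠ i in l, 0 ≤ X i ∧ X i ≤ 1)
    (hq : ∀ᶠ i in l, Summable fun n => v n * X i ^ n)
    (hp : ∀ᶠ i in l, Summable fun n => T n * (v n * X i ^ n))
    (htop : Tendsto (fun i => ∑' n, v n * X i ^ n) l atTop) :
    ∀ᶠ i in l, (∑' n, T n * (v n * X i ^ n)) / (∑' n, v n * X i ^ n) < M := by
  obtain ⟨K, hLK, hKM⟩ := exists_between hLM
  have hL0 : 0 ≤ L := ge_of_tendsto' hL hT
  obtain ⟨N, hN⟩ := eventually_atTop.1 (hL.eventually_lt_const hLK)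
  set C := ∑ n ∈ Finset.range N, T n * v n with hC
  have hCq := (htop.const_mul_atTop (sub_pos.2 hKM)).eventually_gt_atTop C
  filter_upwards [hX, hq, hp, hCq, htop.eventually_gt_atTop 0] with i hXi hqi hpi hCi hqpos
  rw [div_lt_iff₀ hqpos]
  have hfin : HasSum (fun n => if n ∈ Finset.range N then T n * v n else 0) C := by
    have h := hasSum_sum_of_ne_finset_zero (L := .unconditional ℕ) (s := Finset.range N)
      (f := fun n => if n ∈ Finset.range N then T n * v n else 0) (fun n hn => if_neg hn)
    rwa [Finset.sum_congr rfl fun n hn => if_pos hn] at h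
  have hle := hasSum_le (fun n => ?_) hpi.hasSum (hfin.add (hqi.hasSum.mul_left K))
  · linarith
  have hx : 0 ≤ X i ^ n := pow_nonneg hXi.1 n
  have hvx : 0 ≤ v n * X i ^ n := mul_nonneg (hv n) hx
  split_ifs with h
  · have h1 : v n * X i ^ n ≤ v n := mul_le_of_le_one_right (hv n) (pow_le_one₀ hXi.1 hXi.2)
    have h2 := mul_le_mul_of_nonneg_left h1 (hT n)
    have h3 : 0 ≤ K * (v n * X i ^ n) := mul_nonneg (hL0.trans hLK.le) hvx
    linarith
  · rw [zero_add]
    exact mul_le_mul_of_nonneg_right (hN n (by simpa using h)).le hvx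

theorem shiftedFact_pos {s : ℝ} (hs : 0 < s) (n : ℕ) : 0 < shiftedFact s n :=
  Finset.prod_pos fun i _ => by positivity

theorem shiftedFact_succ (s : ℝ) (n : ℕ) :
    shiftedFact s (n + 1) = shiftedFact s n * (s + n) :=
  Finset.prod_range_succ _ _

/-- Ratio of the coefficients of `F(a,b;a+b;x²)` and of `artanh x / x`. -/
noncomputable def hypArtanhRatio (a b : ℝ) (n : ℕ) : ℝ :=
  shiftedFact a n * shiftedFact b n / (shiftedFact (a + b) n * n.factorial) * (2 * n + 1)

theorem hypArtanhRatio_pos {a b : ℝ} (ha : 0 < a) (hb : 0 < b) (n : ℕ) :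
    0 < hypArtanhRatio a b n := by
  have h1 := shiftedFact_pos ha n
  have h2 := shiftedFact_pos hb n
  have h3 := shiftedFact_pos (add_pos ha hb) n
  unfold hypArtanhRatio
  positivity

theorem hypArtanhRatio_zero (a b : ℝ) : hypArtanhRatio a b 0 = 1 := by
  simp [hypArtanhRatio, shiftedFact]

theorem hypArtanhRatio_strictAnti {a b : ℝ} (ha : 0 < a) (ha1 : a < 1) (hb : 0 < b)
    (hb2 : b ≤ 1 / 2) : StrictAnti (hypArtanhRatio a b) := by
  refine strictAnti_nat_of_succ_lt fun n => ?_
  have h1 := shiftedFact_pos ha n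
  have h2 := shiftedFact_pos hb n
  have h3 := shiftedFact_pos (add_pos ha hb) n
  have key : (a + n) * (b + n) * (2 * n + 3) < (a + b + n) * (n + 1) * (2 * n + 1) := by
    have hn : (0 : ℝ) ≤ n := n.cast_nonneg
    have e1 : 0 ≤ (1 - 2 * (a * b)) * n := mul_nonneg (by nlinarith) hn
    have e2 : 0 < a + b - 3 * (a * b) := by
      rcases le_total a (1 / 3) with h | h <;> nlinarith
    nlinarith
  have hstep : hypArtanhRatio a b (n + 1) = hypArtanhRatio a b n *
      ((a + n) * (b + n) * (2 * n + 3) / ((a + b + n) * (n + 1) * (2 * n + 1))) := by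
    have : a + b + n ≠ 0 := by positivity
    simp only [hypArtanhRatio, shiftedFact_succ, Nat.factorial_succ]
    push_cast
    field_simp
    ring
  rw [hstep]
  exact mul_lt_of_lt_one_right (hypArtanhRatio_pos ha hb n)
    ((div_lt_one (by positivity)).2 key)

theorem tendsto_hypArtanhRatio {a b : ℝ} (ha : 0 < a) (hb : 0 < b) :
    Tendsto (hypArtanhRatio a b) atTop (nhds (2 / betaR a b)) := by
  rw [← tendsto_add_atTop_iff_nat 1]
  have hGa := Real.Gamma_pos_of_pos ha
  have hGb := Real.Gamma_pos_of_pos hb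
  have hlim := (((Real.GammaSeq_tendsto_Gamma (a + b)).div
    ((Real.GammaSeq_tendsto_Gamma a).mul (Real.GammaSeq_tendsto_Gamma b))
      (mul_pos hGa hGb).ne')).mul
    ((tendsto_one_div_add_atTop_nhds_zero_nat (𝕜 := ℝ)).const_add 2)
  have hval : 2 / betaR a b =
      Real.Gamma (a + b) / (Real.Gamma a * Real.Gamma b) * (2 + 0) := by
    have := Real.Gamma_pos_of_pos (add_pos ha hb)
    unfold betaR
    field_simp
    ring
  rw [hval]
  refine hlim.congr' ?_
  filter_upwards [eventually_gt_atTop 0] with n hn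
  have hn' : (0 : ℝ) < n := by exact_mod_cast hn
  have h1 := shiftedFact_pos ha (n + 1)
  have h2 := shiftedFact_pos hb (n + 1)
  have h3 := shiftedFact_pos (add_pos ha hb) (n + 1)
  have hseq : ∀ s : ℝ, Real.GammaSeq s n =
      (n : ℝ) ^ s * n.factorial / shiftedFact s (n + 1) := fun s => rfl
  have e1 : (0 : ℝ) < (n : ℝ) ^ a := by positivity
  have e2 : (0 : ℝ) < (n : ℝ) ^ b := by positivity
  simp only [Pi.div_apply, hseq, hypArtanhRatio, Real.rpow_add hn', Nat.factorial_succ]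
  push_cast
  field_simp

theorem hasSum_artanhR_div {r : ℝ} (h0 : 0 < r) (h1 : r < 1) :
    HasSum (fun n : ℕ => 1 / (2 * n + 1 : ℝ) * (r ^ 2) ^ n) (artanhR r / r) := by
  have h := (Real.hasSum_log_sub_log_of_abs_lt_one (abs_lt.2 ⟨by linarith, h1⟩)).mul_left
    (1 / (2 * r))
  have hval : artanhR r / r = 1 / (2 * r) * (Real.log (1 + r) - Real.log (1 - r)) := by
    rw [artanhR, Real.log_div (by linarith) (by linarith)]
    field_simp
  rw [hval]
  refine h.congr_fun fun n => ?_
  rw [← pow_mul, pow_succ]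
  field_simp

theorem tendsto_artanhR_div_atTop :
    Tendsto (fun r => artanhR r / r) (nhdsWithin 1 (Set.Iio 1)) atTop := by
  have hinv : Tendsto (fun r : ℝ => (1 - r)⁻¹) (nhdsWithin 1 (Set.Iio 1)) atTop := by
    refine tendsto_inv_nhdsGT_zero.comp (tendsto_nhdsWithin_iff.2 ⟨?_, ?_⟩)
    · exact (Continuous.tendsto' (by fun_prop) _ _ (by simp)).mono_left nhdsWithin_le_nhds
    · filter_upwards [self_mem_nhdsWithin] with r hr using sub_pos.2 (mem_Iio.1 hr)
  have hnum : Tendsto (fun r : ℝ => 1 + r) (nhdsWithin 1 (Set.Iio 1)) (nhds 2) :=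
    (Continuous.tendsto' (by fun_prop) _ _ (by norm_num)).mono_left nhdsWithin_le_nhds
  have hlog := (Real.tendsto_log_atTop.comp (hnum.pos_mul_atTop two_pos hinv)).const_mul_atTop
    (show (0 : ℝ) < 1 / 2 by norm_num)
  have hr : Tendsto (fun r : ℝ => r⁻¹) (nhdsWithin 1 (Set.Iio 1)) (nhds 1) := by
    have := (tendsto_inv₀ (one_ne_zero (α := ℝ)))
    rw [inv_one] at this
    exact this.mono_left nhdsWithin_le_nhds
  exact hlog.atTop_mul_pos one_pos hr

theorem summable_mul_artanh_pow {T : ℕ → ℝ} {x : ℝ} (hT0 : ∀ n, 0 ≤ T n) (hT1 : ∀ n, T n ≤ 1)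
    (hx0 : 0 ≤ x) (hx1 : x < 1) :
    Summable fun n : ℕ => T n * (1 / (2 * n + 1 : ℝ) * x ^ n) := by
  refine Summable.of_nonneg_of_le (fun n => mul_nonneg (hT0 n) (by positivity)) (fun n => ?_)
    (summable_geometric_of_lt_one hx0 hx1)
  have h1 : 1 / (2 * n + 1 : ℝ) ≤ 1 := by
    rw [div_le_one (by positivity)]
    linarith [(n.cast_nonneg : (0 : ℝ) ≤ n)]
  calc T n * (1 / (2 * n + 1 : ℝ) * x ^ n) ≤ 1 * (1 * x ^ n) := by
        gcongr
        exact hT1 n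
    _ = x ^ n := by ring

theorem hypF_eq_tsum_hypArtanhRatio (a b x : ℝ) :
    hypF a b (a + b) x = ∑' n : ℕ, hypArtanhRatio a b n * (1 / (2 * n + 1 : ℝ) * x ^ n) := by
  refine tsum_congr fun n => ?_
  have : (2 * n + 1 : ℝ) ≠ 0 := by positivity
  simp only [hypArtanhRatio]
  field_simp

theorem stmt19 (a c : ℝ) (ha : 0 < a) (ha' : a < min c 1) (hc : c ≤ a + 1 / 2)
    (B : ℝ) (hB : B = betaR a (c - a))
    (f : ℝ → ℝ)
    (hf : ∀ r, f r = r * Kg a (c - a) c r / artanhR r) :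
    StrictAntiOn f (Set.Ioo 0 1) ∧
    Tendsto f (nhdsWithin 0 (Set.Ioi 0)) (nhds (B / 2)) ∧
    Tendsto f (nhdsWithin 1 (Set.Iio 1)) (nhds 1) ∧
    ∀ r ∈ Set.Ioo (0 : ℝ) 1, 1 < f r ∧ f r < B / 2 := by
  obtain ⟨hac, ha1⟩ := lt_min_iff.1 ha'
  obtain ⟨b, rfl⟩ : ∃ b, c = a + b := ⟨c - a, by ring⟩
  have hb : 0 < b := by linarith
  have hb2 : b ≤ 1 / 2 := by linarith
  rw [add_sub_cancel_left] at hB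
  set T := hypArtanhRatio a b
  have hTpos : ∀ n, 0 < T n := hypArtanhRatio_pos ha hb
  have hTanti : StrictAnti T := hypArtanhRatio_strictAnti ha ha1 hb hb2
  have hT0 : T 0 = 1 := hypArtanhRatio_zero a b
  have hT1 : ∀ n, T n ≤ 1 := fun n => hT0 ▸ hTanti.antitone n.zero_le
  have hTlim : Tendsto T atTop (nhds (2 / B)) := hB ▸ tendsto_hypArtanhRatio ha hb
  have hTgt : ∀ n, 2 / B < T n := fun n =>
    (hTanti.antitone.le_of_tendsto hTlim (n + 1)).trans_lt (hTanti n.lt_succ_self)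
  have hB0 : 0 < B := by
    rw [hB]
    exact div_pos (mul_pos (Real.Gamma_pos_of_pos ha) (Real.Gamma_pos_of_pos hb))
      (Real.Gamma_pos_of_pos (add_pos ha hb))
  set v : ℕ → ℝ := fun n => 1 / (2 * n + 1) with hvdef
  have hv : ∀ n, 0 < v n := fun n => by positivity
  have hsq : ∀ {r : ℝ}, r ∈ Ioo (0 : ℝ) 1 → 0 < r ^ 2 ∧ r ^ 2 < 1 := fun hr =>
    ⟨pow_pos hr.1 2, pow_lt_one₀ hr.1.le hr.2 two_ne_zero⟩
  have hq : ∀ {r : ℝ}, r ∈ Ioo (0 : ℝ) 1 → HasSum (fun n => v n * (r ^ 2) ^ n) (artanhR r / r) :=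
    fun hr => hasSum_artanhR_div hr.1 hr.2
  have hp : ∀ {r : ℝ}, r ∈ Ioo (0 : ℝ) 1 → Summable fun n => T n * (v n * (r ^ 2) ^ n) :=
    fun hr => summable_mul_artanh_pow (fun n => (hTpos n).le) hT1 (hsq hr).1.le (hsq hr).2
  have hqpos : ∀ {r : ℝ}, r ∈ Ioo (0 : ℝ) 1 → 1 ≤ ∑' n, v n * (r ^ 2) ^ n := fun {r} hr => by
    have h := (hq hr).summable.le_tsum 0 fun n _ => mul_nonneg (hv n).le (by positivity)
    simpa [hvdef] using h
  have hfeq : ∀ {r : ℝ}, r ∈ Ioo (0 : ℝ) 1 → f r = B / 2 *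
      ((∑' n, T n * (v n * (r ^ 2) ^ n)) / ∑' n, v n * (r ^ 2) ^ n) := fun {r} hr => by
    have hr0 := hr.1.ne'
    rw [hf, Kg, add_sub_cancel_left, hypF_eq_tsum_hypArtanhRatio, (hq hr).tsum_eq, ← hB,
      div_div_eq_mul_div]
    ring
  have hlower : ∀ r ∈ Ioo (0 : ℝ) 1, 1 < f r := fun r hr => by
    have hpos := zero_lt_one.trans_le (hqpos hr)
    have h : 2 / B * (∑' n, v n * (r ^ 2) ^ n) < ∑' n, T n * (v n * (r ^ 2) ^ n) := by
      rw [← tsum_mul_left]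
      have hlt : ∀ n, 2 / B * (v n * (r ^ 2) ^ n) < T n * (v n * (r ^ 2) ^ n) := fun n =>
        mul_lt_mul_of_pos_right (hTgt n) (mul_pos (hv n) (pow_pos (hsq hr).1 n))
      exact Summable.tsum_lt_tsum (i := 0) (fun n => (hlt n).le) (hlt 0)
        ((hq hr).summable.mul_left _) (hp hr)
    rw [← lt_div_iff₀ hpos, div_lt_iff₀' hB0] at h
    rw [hfeq hr]
    linarith
  have hupper : ∀ r ∈ Ioo (0 : ℝ) 1, f r < B / 2 := fun r hr => by
    have hpos := zero_lt_one.trans_le (hqpos hr)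
    have h : ∑' n, T n * (v n * (r ^ 2) ^ n) < ∑' n, v n * (r ^ 2) ^ n := by
      refine Summable.tsum_lt_tsum (i := 1) (fun n => mul_le_of_le_one_left
        (mul_pos (hv n) (pow_pos (hsq hr).1 n)).le (hT1 n)) ?_ (hp hr) (hq hr).summable
      exact mul_lt_of_lt_one_left (mul_pos (hv 1) (pow_pos (hsq hr).1 1))
        (hT0 ▸ hTanti zero_lt_one)
    rw [hfeq hr]
    exact mul_lt_of_lt_one_right (half_pos hB0) ((div_lt_one hpos).2 h)
  have hnear0 : ∀ᶠ r : ℝ in nhdsWithin 0 (Ioi 0), r ∈ Ioo (0 : ℝ) 1 :=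
    Ioo_mem_nhdsGT zero_lt_one
  have hnear1 : ∀ᶠ r : ℝ in nhdsWithin 1 (Iio 1), r ∈ Ioo (0 : ℝ) 1 :=
    Ioo_mem_nhdsLT zero_lt_one
  refine ⟨fun r hr s hs hrs => ?_, ?_, ?_, fun r hr => ⟨hlower r hr, hupper r hr⟩⟩
  · rw [hfeq hr, hfeq hs]
    refine mul_lt_mul_of_pos_left ?_ (half_pos hB0)
    rw [div_lt_div_iff₀ (zero_lt_one.trans_le (hqpos hs)) (zero_lt_one.trans_le (hqpos hr))]
    exact tsum_mul_pow_cross_lt hTanti hv (hsq hr).1 (pow_lt_pow_left₀ hrs hr.1.le two_ne_zero)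
      (hq hr).summable (hq hs).summable (hp hr) (hp hs)
  · have hg : Tendsto (fun r : ℝ => B / 2 * (1 - r ^ 2)) (nhdsWithin 0 (Ioi 0))
        (nhds (B / 2)) :=
      (Continuous.tendsto' (by fun_prop) _ _ (by simp)).mono_left nhdsWithin_le_nhds
    refine tendsto_of_tendsto_of_tendsto_of_le_of_le' hg tendsto_const_nhds ?_
      (hnear0.mono fun r hr => (hupper r hr).le)
    filter_upwards [hnear0] with r hr
    rw [hfeq hr]
    refine mul_le_mul_of_nonneg_left ?_ (half_pos hB0).le
    rw [le_div_iff₀ (zero_lt_one.trans_le (hqpos hr)), (hq hr).tsum_eq]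
    have hp0 : 1 ≤ ∑' n, T n * (v n * (r ^ 2) ^ n) := by
      have h := (hp hr).le_tsum 0 fun n _ =>
        mul_nonneg (hTpos n).le (mul_nonneg (hv n).le (pow_nonneg (sq_nonneg r) n))
      simpa [hvdef, hT0] using h
    have hgeom : artanhR r / r ≤ (1 - r ^ 2)⁻¹ := by
      refine hasSum_le (fun n => ?_) (hq hr) (hasSum_geometric_of_lt_one (hsq hr).1.le (hsq hr).2)
      refine mul_le_of_le_one_left (pow_nonneg (sq_nonneg r) n) ?_
      rw [hvdef, div_le_one (by positivity)]
      linarith [(n.cast_nonneg : (0 : ℝ) ≤ n)]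
    have hpos : 0 < 1 - r ^ 2 := sub_pos.2 (hsq hr).2
    calc (1 - r ^ 2) * (artanhR r / r) ≤ (1 - r ^ 2) * (1 - r ^ 2)⁻¹ := by gcongr
      _ = 1 := mul_inv_cancel₀ hpos.ne'
      _ ≤ _ := hp0
  · refine tendsto_order.2 ⟨fun m hm => ?_, fun M hM => ?_⟩
    · filter_upwards [hnear1] with r hr using hm.trans (hlower r hr)
    · have htop : Tendsto (fun r : ℝ => ∑' n, v n * (r ^ 2) ^ n) (nhdsWithin 1 (Iio 1)) atTop :=
        tendsto_artanhR_div_atTop.congr'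
          (by filter_upwards [hnear1] with r hr using (hq hr).tsum_eq.symm)
      have hM' : 2 / B < 2 / B * M := lt_mul_of_one_lt_right (by positivity) hM
      have hev := eventually_tsum_mul_pow_div_lt hM' (fun n => (hTpos n).le) (fun n => (hv n).le)
        hTlim (hnear1.mono fun r hr => ⟨(hsq hr).1.le, (hsq hr).2.le⟩)
        (hnear1.mono fun r hr => (hq hr).summable) (hnear1.mono fun r hr => hp hr) htop
      filter_upwards [hev, hnear1] with r h hr
      rw [hfeq hr]
      calc _ < B / 2 * (2 / B * M) := mul_lt_mul_of_pos_left h (half_pos hB0)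
        _ = M := by field_simp
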